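/- Every 3×3 doubly stochastic matrix satisfying SD-envy-freeness (with respect to three strict preferences over three objects) admits a decomposition into permutation matrices such that, for each ordered pair of agents (i, i'), the total probability of permutation matrices in which agent i envies agent i' is at most 1/2. -/

import Mathlib

/-- A doubly stochastic assignment matrix: nonnegative entries, each row and column sums to 1. -/
def DoublyStochastic (n : ℕ) (P : Fin n → Fin n → ℝ) : Prop :=
  (∀ i o, 0 ≤ P i o) ∧ (∀ i, ∑ o, P i o = 1) ∧ (∀ o, ∑ i, P i o = 1)

/-- SD-envy-freeness: `rank i o` is the position of object `o` in agent `i`'s strict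
preference (smaller = more preferred). For all agents `i, i'` and objects `o`, the mass agent
`i` gets on objects weakly preferred (by `i`) to `o` is at least the mass `i'` gets there. -/
def SDEF (n : ℕ) (rank : Fin n → Equiv.Perm (Fin n)) (P : Fin n → Fin n → ℝ) : Prop :=
  ∀ i i' o : Fin n,
    ∑ o' ∈ Finset.univ.filter (fun o' => rank i o' ≤ rank i o), P i' o' ≤
    ∑ o' ∈ Finset.univ.filter (fun o' => rank i o' ≤ rank i o), P i o'

/-- A decomposition of an assignment matrix: a probability distribution over deterministic
assignments (permutations `σ`, where `σ i` is the object of agent `i`) whose marginals are `P`. -/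
def IsDecomposition (n : ℕ) (P : Fin n → Fin n → ℝ) (w : Equiv.Perm (Fin n) → ℝ) : Prop :=
  (∀ σ, 0 ≤ w σ) ∧ (∑ σ, w σ = 1) ∧
  ∀ i o, ∑ σ ∈ Finset.univ.filter (fun σ : Equiv.Perm (Fin n) => σ i = o), w σ = P i o

/-- The probability, under the distribution `w` over deterministic assignments, that agent `i`
envies agent `i'` (i.e. strictly prefers `i'`'s object to her own). -/
def envyProb (n : ℕ) (rank : Fin n → Equiv.Perm (Fin n)) (w : Equiv.Perm (Fin n) → ℝ)
    (i i' : Fin n) : ℝ :=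
  ∑ σ ∈ Finset.univ.filter (fun σ : Equiv.Perm (Fin n) => rank i (σ i') < rank i (σ i)), w σ

/-! The decompositions of a 3×3 doubly stochastic matrix form a one-parameter family
(parameter `x` = weight of the identity). Every envy constraint bounds `x` from above or from
below, so it suffices to compare each lower bound with each upper bound. -/

namespace ThreeAgents

def q1 : Equiv.Perm (Fin 3) := ⟨![0,1,2], ![0,1,2], by decide, by decide⟩
def q2 : Equiv.Perm (Fin 3) := ⟨![1,2,0], ![2,0,1], by decide, by decide⟩
def q3 : Equiv.Perm (Fin 3) := ⟨![2,0,1], ![1,2,0], by decide, by decide⟩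
def q4 : Equiv.Perm (Fin 3) := ⟨![0,2,1], ![0,2,1], by decide, by decide⟩
def q5 : Equiv.Perm (Fin 3) := ⟨![1,0,2], ![1,0,2], by decide, by decide⟩
def q6 : Equiv.Perm (Fin 3) := ⟨![2,1,0], ![2,1,0], by decide, by decide⟩

theorem q1_val : q1 0 = 0 ∧ q1 1 = 1 ∧ q1 2 = 2 := by decide
theorem q2_val : q2 0 = 1 ∧ q2 1 = 2 ∧ q2 2 = 0 := by decide
theorem q3_val : q3 0 = 2 ∧ q3 1 = 0 ∧ q3 2 = 1 := by decide
theorem q4_val : q4 0 = 0 ∧ q4 1 = 2 ∧ q4 2 = 1 := by decide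
theorem q5_val : q5 0 = 1 ∧ q5 1 = 0 ∧ q5 2 = 2 := by decide
theorem q6_val : q6 0 = 2 ∧ q6 1 = 1 ∧ q6 2 = 0 := by decide

theorem univ_eq : (Finset.univ : Finset (Equiv.Perm (Fin 3))) = {q1, q2, q3, q4, q5, q6} := by
  decide

theorem sum_six (f : Equiv.Perm (Fin 3) → ℝ) :
    ∑ σ, f σ = f q1 + f q2 + f q3 + f q4 + f q5 + f q6 := by
  rw [univ_eq, Finset.sum_insert (by decide), Finset.sum_insert (by decide),
    Finset.sum_insert (by decide), Finset.sum_insert (by decide),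
    Finset.sum_insert (by decide), Finset.sum_singleton]
  ring

theorem cases_six (r : Equiv.Perm (Fin 3)) :
    r = q1 ∨ r = q2 ∨ r = q3 ∨ r = q4 ∨ r = q5 ∨ r = q6 := by
  have h := Finset.mem_univ r
  rw [univ_eq] at h
  simpa using h

/-- The decomposition in which the identity has weight `x`. -/
noncomputable def wt (P : Fin 3 → Fin 3 → ℝ) (x : ℝ) (σ : Equiv.Perm (Fin 3)) : ℝ :=
  if σ 0 = 0 then (if σ 1 = 1 then x else P 0 0 - x)
  else if σ 0 = 1 then (if σ 1 = 2 then P 1 2 - P 0 0 + x else P 2 2 - x)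
  else (if σ 1 = 0 then P 1 0 - P 2 2 + x else P 1 1 - x)

/-- Probability that an agent `i` with preference `r` envies `j`. -/
noncomputable def env (P : Fin 3 → Fin 3 → ℝ) (x : ℝ) (r : Equiv.Perm (Fin 3)) (i j : Fin 3) : ℝ :=
  ∑ σ, if r (σ j) < r (σ i) then wt P x σ else 0

def Even3 (r : Equiv.Perm (Fin 3)) : Prop := r 1 = r 0 + 1

instance (r : Equiv.Perm (Fin 3)) : Decidable (Even3 r) :=
  inferInstanceAs (Decidable (r 1 = r 0 + 1))

noncomputable def up (P : Fin 3 → Fin 3 → ℝ) (r : Equiv.Perm (Fin 3)) (i : Fin 3) : ℝ :=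
  if Even3 r then 1 / 2 - env P 0 r i (i + 2) else 1 / 2 - env P 0 r i (i + 1)

noncomputable def lo (P : Fin 3 → Fin 3 → ℝ) (r : Equiv.Perm (Fin 3)) (i : Fin 3) : ℝ :=
  if Even3 r then env P 0 r i (i + 1) - 1 / 2 else env P 0 r i (i + 2) - 1 / 2

/-- SD-envy-freeness of agent `i` with preference `r`. -/
def SD (P : Fin 3 → Fin 3 → ℝ) (r : Equiv.Perm (Fin 3)) (i : Fin 3) : Prop :=
  ∀ i' o, (∑ o', if r o' ≤ r o then P i' o' else 0) ≤ ∑ o', if r o' ≤ r o then P i o' else 0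

set_option maxHeartbeats 1000000 in
theorem env_slope (P : Fin 3 → Fin 3 → ℝ) (x : ℝ) (r : Equiv.Perm (Fin 3)) (i : Fin 3) :
    (Even3 r → env P x r i (i + 1) = env P 0 r i (i + 1) - x ∧
      env P x r i (i + 2) = env P 0 r i (i + 2) + x) ∧
    (¬ Even3 r → env P x r i (i + 1) = env P 0 r i (i + 1) + x ∧
      env P x r i (i + 2) = env P 0 r i (i + 2) - x) := by
  rcases cases_six r with rfl | rfl | rfl | rfl | rfl | rfl <;> fin_cases i <;>
    simp [Even3, env, sum_six, wt, q1_val, q2_val, q3_val, q4_val, q5_val, q6_val] <;>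
    (try constructor) <;> ring

theorem env_le (P : Fin 3 → Fin 3 → ℝ) (x : ℝ) (r : Equiv.Perm (Fin 3)) (i : Fin 3)
    (hl : lo P r i ≤ x) (hu : x ≤ up P r i) :
    env P x r i (i + 1) ≤ 1 / 2 ∧ env P x r i (i + 2) ≤ 1 / 2 := by
  have h := env_slope P x r i
  unfold lo at hl
  unfold up at hu
  by_cases he : Even3 r
  · obtain ⟨h1, h2⟩ := h.1 he
    rw [if_pos he] at hl hu
    constructor <;> linarith
  · obtain ⟨h1, h2⟩ := h.2 he
    rw [if_neg he] at hl hu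
    constructor <;> linarith

/-- Double stochasticity, unfolded. -/
theorem ds_facts {P : Fin 3 → Fin 3 → ℝ} (hds : DoublyStochastic 3 P) :
    (P 0 0 + P 0 1 + P 0 2 = 1 ∧ P 1 0 + P 1 1 + P 1 2 = 1 ∧ P 2 0 + P 2 1 + P 2 2 = 1) ∧
    (P 0 0 + P 1 0 + P 2 0 = 1 ∧ P 0 1 + P 1 1 + P 2 1 = 1 ∧ P 0 2 + P 1 2 + P 2 2 = 1) := by
  obtain ⟨hn, hr, hc⟩ := hds
  simpa [Fin.forall_fin_succ, Fin.sum_univ_three] using And.intro hr hc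

/-- The two bounds on `x` and the envy-freeness of agent 0, in each of the six cases. -/
theorem agent0 (P : Fin 3 → Fin 3 → ℝ) (hds : DoublyStochastic 3 P) (r : Equiv.Perm (Fin 3))
    (h : SD P r 0) :
    (lo P r 0 ≤ P 2 2 + P 0 2 - 1 / 2 ∧ 1 / 2 - P 0 2 - (P 1 2 - P 0 0) ≤ up P r 0 ∧
      P 1 0 ≤ P 0 0 ∧ P 2 0 ≤ P 0 0 ∧ P 0 2 ≤ P 1 2 ∧ P 0 2 ≤ P 2 2) ∨
    (lo P r 0 ≤ P 0 0 + P 0 1 - 1 / 2 ∧ 1 / 2 - P 0 1 - 0 ≤ up P r 0 ∧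
      P 1 2 ≤ P 0 2 ∧ P 2 2 ≤ P 0 2 ∧ P 0 1 ≤ P 1 1 ∧ P 0 1 ≤ P 2 1) ∨
    (lo P r 0 ≤ P 1 1 + P 0 0 - 1 / 2 ∧ 1 / 2 - P 0 0 - (P 1 0 - P 2 2) ≤ up P r 0 ∧
      P 1 1 ≤ P 0 1 ∧ P 2 1 ≤ P 0 1 ∧ P 0 0 ≤ P 1 0 ∧ P 0 0 ≤ P 2 0) ∨
    (lo P r 0 ≤ P 1 1 + P 0 1 - 1 / 2 ∧ 1 / 2 - P 0 1 - (P 1 0 - P 2 2) ≤ up P r 0 ∧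
      P 1 0 ≤ P 0 0 ∧ P 2 0 ≤ P 0 0 ∧ P 0 1 ≤ P 1 1 ∧ P 0 1 ≤ P 2 1) ∨
    (lo P r 0 ≤ P 0 0 + P 0 2 - 1 / 2 ∧ 1 / 2 - P 0 2 - 0 ≤ up P r 0 ∧
      P 1 1 ≤ P 0 1 ∧ P 2 1 ≤ P 0 1 ∧ P 0 2 ≤ P 1 2 ∧ P 0 2 ≤ P 2 2) ∨
    (lo P r 0 ≤ P 2 2 + P 0 0 - 1 / 2 ∧ 1 / 2 - P 0 0 - (P 1 2 - P 0 0) ≤ up P r 0 ∧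
      P 1 2 ≤ P 0 2 ∧ P 2 2 ≤ P 0 2 ∧ P 0 0 ≤ P 1 0 ∧ P 0 0 ≤ P 2 0) := by
  obtain ⟨⟨hr0, hr1, hr2⟩, hc0, hc1, hc2⟩ := ds_facts hds
  have ha := fun k => h k (r.symm 0)
  have hb := fun k => h k (r.symm 1)
  rcases cases_six r with rfl | rfl | rfl | rfl | rfl | rfl
  · refine Or.inl ?_
    rw [show q1.symm 0 = 0 by decide] at ha
    rw [show q1.symm 1 = 1 by decide] at hb
    simp [Fin.forall_fin_succ, Fin.sum_univ_three, q1_val] at ha hb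
    refine ⟨?_, ?_, by linarith, by linarith, by linarith, by linarith⟩ <;>
      simp [Even3, lo, up, env, sum_six, wt,
        q1_val, q2_val, q3_val, q4_val, q5_val, q6_val] <;> linarith
  · refine Or.inr ?_
    refine Or.inl ?_
    rw [show q2.symm 0 = 2 by decide] at ha
    rw [show q2.symm 1 = 0 by decide] at hb
    simp [Fin.forall_fin_succ, Fin.sum_univ_three, q2_val] at ha hb
    refine ⟨?_, ?_, by linarith, by linarith, by linarith, by linarith⟩ <;>
      simp [Even3, lo, up, env, sum_six, wt,
        q1_val, q2_val, q3_val, q4_val, q5_val, q6_val] <;> linarith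
  · refine Or.inr ?_
    refine Or.inr ?_
    refine Or.inl ?_
    rw [show q3.symm 0 = 1 by decide] at ha
    rw [show q3.symm 1 = 2 by decide] at hb
    simp [Fin.forall_fin_succ, Fin.sum_univ_three, q3_val] at ha hb
    refine ⟨?_, ?_, by linarith, by linarith, by linarith, by linarith⟩ <;>
      simp [Even3, lo, up, env, sum_six, wt,
        q1_val, q2_val, q3_val, q4_val, q5_val, q6_val] <;> linarith
  · refine Or.inr ?_
    refine Or.inr ?_
    refine Or.inr ?_
    refine Or.inl ?_
    rw [show q4.symm 0 = 0 by decide] at ha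
    rw [show q4.symm 1 = 2 by decide] at hb
    simp [Fin.forall_fin_succ, Fin.sum_univ_three, q4_val] at ha hb
    refine ⟨?_, ?_, by linarith, by linarith, by linarith, by linarith⟩ <;>
      simp [Even3, lo, up, env, sum_six, wt,
        q1_val, q2_val, q3_val, q4_val, q5_val, q6_val] <;> linarith
  · refine Or.inr ?_
    refine Or.inr ?_
    refine Or.inr ?_
    refine Or.inr ?_
    refine Or.inl ?_
    rw [show q5.symm 0 = 1 by decide] at ha
    rw [show q5.symm 1 = 0 by decide] at hb
    simp [Fin.forall_fin_succ, Fin.sum_univ_three, q5_val] at ha hb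
    refine ⟨?_, ?_, by linarith, by linarith, by linarith, by linarith⟩ <;>
      simp [Even3, lo, up, env, sum_six, wt,
        q1_val, q2_val, q3_val, q4_val, q5_val, q6_val] <;> linarith
  · refine Or.inr ?_
    refine Or.inr ?_
    refine Or.inr ?_
    refine Or.inr ?_
    refine Or.inr ?_
    rw [show q6.symm 0 = 2 by decide] at ha
    rw [show q6.symm 1 = 1 by decide] at hb
    simp [Fin.forall_fin_succ, Fin.sum_univ_three, q6_val] at ha hb
    refine ⟨?_, ?_, by linarith, by linarith, by linarith, by linarith⟩ <;>
      simp [Even3, lo, up, env, sum_six, wt,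
        q1_val, q2_val, q3_val, q4_val, q5_val, q6_val] <;> linarith

/-- The two bounds on `x` and the envy-freeness of agent 1, in each of the six cases. -/
theorem agent1 (P : Fin 3 → Fin 3 → ℝ) (hds : DoublyStochastic 3 P) (r : Equiv.Perm (Fin 3))
    (h : SD P r 1) :
    (lo P r 1 ≤ P 1 1 + P 1 2 - 1 / 2 ∧ 1 / 2 - P 1 2 - 0 ≤ up P r 1 ∧
      P 0 0 ≤ P 1 0 ∧ P 2 0 ≤ P 1 0 ∧ P 1 2 ≤ P 0 2 ∧ P 1 2 ≤ P 2 2) ∨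
    (lo P r 1 ≤ P 2 2 + P 1 1 - 1 / 2 ∧ 1 / 2 - P 1 1 - (P 1 0 - P 2 2) ≤ up P r 1 ∧
      P 0 2 ≤ P 1 2 ∧ P 2 2 ≤ P 1 2 ∧ P 1 1 ≤ P 0 1 ∧ P 1 1 ≤ P 2 1) ∨
    (lo P r 1 ≤ P 0 0 + P 1 0 - 1 / 2 ∧ 1 / 2 - P 1 0 - (P 1 2 - P 0 0) ≤ up P r 1 ∧
      P 0 1 ≤ P 1 1 ∧ P 2 1 ≤ P 1 1 ∧ P 1 0 ≤ P 0 0 ∧ P 1 0 ≤ P 2 0) ∨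
    (lo P r 1 ≤ P 0 0 + P 1 1 - 1 / 2 ∧ 1 / 2 - P 1 1 - (P 1 2 - P 0 0) ≤ up P r 1 ∧
      P 0 0 ≤ P 1 0 ∧ P 2 0 ≤ P 1 0 ∧ P 1 1 ≤ P 0 1 ∧ P 1 1 ≤ P 2 1) ∨
    (lo P r 1 ≤ P 2 2 + P 1 2 - 1 / 2 ∧ 1 / 2 - P 1 2 - (P 1 0 - P 2 2) ≤ up P r 1 ∧
      P 0 1 ≤ P 1 1 ∧ P 2 1 ≤ P 1 1 ∧ P 1 2 ≤ P 0 2 ∧ P 1 2 ≤ P 2 2) ∨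
    (lo P r 1 ≤ P 1 1 + P 1 0 - 1 / 2 ∧ 1 / 2 - P 1 0 - 0 ≤ up P r 1 ∧
      P 0 2 ≤ P 1 2 ∧ P 2 2 ≤ P 1 2 ∧ P 1 0 ≤ P 0 0 ∧ P 1 0 ≤ P 2 0) := by
  obtain ⟨⟨hr0, hr1, hr2⟩, hc0, hc1, hc2⟩ := ds_facts hds
  have ha := fun k => h k (r.symm 0)
  have hb := fun k => h k (r.symm 1)
  rcases cases_six r with rfl | rfl | rfl | rfl | rfl | rfl
  · refine Or.inl ?_
    rw [show q1.symm 0 = 0 by decide] at ha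
    rw [show q1.symm 1 = 1 by decide] at hb
    simp [Fin.forall_fin_succ, Fin.sum_univ_three, q1_val] at ha hb
    refine ⟨?_, ?_, by linarith, by linarith, by linarith, by linarith⟩ <;>
      simp [Even3, lo, up, env, sum_six, wt,
        q1_val, q2_val, q3_val, q4_val, q5_val, q6_val] <;> linarith
  · refine Or.inr ?_
    refine Or.inl ?_
    rw [show q2.symm 0 = 2 by decide] at ha
    rw [show q2.symm 1 = 0 by decide] at hb
    simp [Fin.forall_fin_succ, Fin.sum_univ_three, q2_val] at ha hb
    refine ⟨?_, ?_, by linarith, by linarith, by linarith, by linarith⟩ <;>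
      simp [Even3, lo, up, env, sum_six, wt,
        q1_val, q2_val, q3_val, q4_val, q5_val, q6_val] <;> linarith
  · refine Or.inr ?_
    refine Or.inr ?_
    refine Or.inl ?_
    rw [show q3.symm 0 = 1 by decide] at ha
    rw [show q3.symm 1 = 2 by decide] at hb
    simp [Fin.forall_fin_succ, Fin.sum_univ_three, q3_val] at ha hb
    refine ⟨?_, ?_, by linarith, by linarith, by linarith, by linarith⟩ <;>
      simp [Even3, lo, up, env, sum_six, wt,
        q1_val, q2_val, q3_val, q4_val, q5_val, q6_val] <;> linarith
  · refine Or.inr ?_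
    refine Or.inr ?_
    refine Or.inr ?_
    refine Or.inl ?_
    rw [show q4.symm 0 = 0 by decide] at ha
    rw [show q4.symm 1 = 2 by decide] at hb
    simp [Fin.forall_fin_succ, Fin.sum_univ_three, q4_val] at ha hb
    refine ⟨?_, ?_, by linarith, by linarith, by linarith, by linarith⟩ <;>
      simp [Even3, lo, up, env, sum_six, wt,
        q1_val, q2_val, q3_val, q4_val, q5_val, q6_val] <;> linarith
  · refine Or.inr ?_
    refine Or.inr ?_
    refine Or.inr ?_
    refine Or.inr ?_
    refine Or.inl ?_
    rw [show q5.symm 0 = 1 by decide] at ha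
    rw [show q5.symm 1 = 0 by decide] at hb
    simp [Fin.forall_fin_succ, Fin.sum_univ_three, q5_val] at ha hb
    refine ⟨?_, ?_, by linarith, by linarith, by linarith, by linarith⟩ <;>
      simp [Even3, lo, up, env, sum_six, wt,
        q1_val, q2_val, q3_val, q4_val, q5_val, q6_val] <;> linarith
  · refine Or.inr ?_
    refine Or.inr ?_
    refine Or.inr ?_
    refine Or.inr ?_
    refine Or.inr ?_
    rw [show q6.symm 0 = 2 by decide] at ha
    rw [show q6.symm 1 = 1 by decide] at hb
    simp [Fin.forall_fin_succ, Fin.sum_univ_three, q6_val] at ha hb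
    refine ⟨?_, ?_, by linarith, by linarith, by linarith, by linarith⟩ <;>
      simp [Even3, lo, up, env, sum_six, wt,
        q1_val, q2_val, q3_val, q4_val, q5_val, q6_val] <;> linarith

/-- The two bounds on `x` and the envy-freeness of agent 2, in each of the six cases. -/
theorem agent2 (P : Fin 3 → Fin 3 → ℝ) (hds : DoublyStochastic 3 P) (r : Equiv.Perm (Fin 3))
    (h : SD P r 2) :
    (lo P r 2 ≤ P 0 0 + P 2 2 - 1 / 2 ∧ 1 / 2 - P 2 2 - (P 1 0 - P 2 2) ≤ up P r 2 ∧
      P 0 0 ≤ P 2 0 ∧ P 1 0 ≤ P 2 0 ∧ P 2 2 ≤ P 0 2 ∧ P 2 2 ≤ P 1 2) ∨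
    (lo P r 2 ≤ P 1 1 + P 2 1 - 1 / 2 ∧ 1 / 2 - P 2 1 - (P 1 2 - P 0 0) ≤ up P r 2 ∧
      P 0 2 ≤ P 2 2 ∧ P 1 2 ≤ P 2 2 ∧ P 2 1 ≤ P 0 1 ∧ P 2 1 ≤ P 1 1) ∨
    (lo P r 2 ≤ P 2 2 + P 2 0 - 1 / 2 ∧ 1 / 2 - P 2 0 - 0 ≤ up P r 2 ∧
      P 0 1 ≤ P 2 1 ∧ P 1 1 ≤ P 2 1 ∧ P 2 0 ≤ P 0 0 ∧ P 2 0 ≤ P 1 0) ∨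
    (lo P r 2 ≤ P 2 2 + P 2 1 - 1 / 2 ∧ 1 / 2 - P 2 1 - 0 ≤ up P r 2 ∧
      P 0 0 ≤ P 2 0 ∧ P 1 0 ≤ P 2 0 ∧ P 2 1 ≤ P 0 1 ∧ P 2 1 ≤ P 1 1) ∨
    (lo P r 2 ≤ P 1 1 + P 2 2 - 1 / 2 ∧ 1 / 2 - P 2 2 - (P 1 2 - P 0 0) ≤ up P r 2 ∧
      P 0 1 ≤ P 2 1 ∧ P 1 1 ≤ P 2 1 ∧ P 2 2 ≤ P 0 2 ∧ P 2 2 ≤ P 1 2) ∨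
    (lo P r 2 ≤ P 0 0 + P 2 0 - 1 / 2 ∧ 1 / 2 - P 2 0 - (P 1 0 - P 2 2) ≤ up P r 2 ∧
      P 0 2 ≤ P 2 2 ∧ P 1 2 ≤ P 2 2 ∧ P 2 0 ≤ P 0 0 ∧ P 2 0 ≤ P 1 0) := by
  obtain ⟨⟨hr0, hr1, hr2⟩, hc0, hc1, hc2⟩ := ds_facts hds
  have ha := fun k => h k (r.symm 0)
  have hb := fun k => h k (r.symm 1)
  rcases cases_six r with rfl | rfl | rfl | rfl | rfl | rfl
  · refine Or.inl ?_
    rw [show q1.symm 0 = 0 by decide] at ha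
    rw [show q1.symm 1 = 1 by decide] at hb
    simp [Fin.forall_fin_succ, Fin.sum_univ_three, q1_val] at ha hb
    refine ⟨?_, ?_, by linarith, by linarith, by linarith, by linarith⟩ <;>
      simp [Even3, lo, up, env, sum_six, wt,
        q1_val, q2_val, q3_val, q4_val, q5_val, q6_val] <;> linarith
  · refine Or.inr ?_
    refine Or.inl ?_
    rw [show q2.symm 0 = 2 by decide] at ha
    rw [show q2.symm 1 = 0 by decide] at hb
    simp [Fin.forall_fin_succ, Fin.sum_univ_three, q2_val] at ha hb
    refine ⟨?_, ?_, by linarith, by linarith, by linarith, by linarith⟩ <;>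
      simp [Even3, lo, up, env, sum_six, wt,
        q1_val, q2_val, q3_val, q4_val, q5_val, q6_val] <;> linarith
  · refine Or.inr ?_
    refine Or.inr ?_
    refine Or.inl ?_
    rw [show q3.symm 0 = 1 by decide] at ha
    rw [show q3.symm 1 = 2 by decide] at hb
    simp [Fin.forall_fin_succ, Fin.sum_univ_three, q3_val] at ha hb
    refine ⟨?_, ?_, by linarith, by linarith, by linarith, by linarith⟩ <;>
      simp [Even3, lo, up, env, sum_six, wt,
        q1_val, q2_val, q3_val, q4_val, q5_val, q6_val] <;> linarith
  · refine Or.inr ?_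
    refine Or.inr ?_
    refine Or.inr ?_
    refine Or.inl ?_
    rw [show q4.symm 0 = 0 by decide] at ha
    rw [show q4.symm 1 = 2 by decide] at hb
    simp [Fin.forall_fin_succ, Fin.sum_univ_three, q4_val] at ha hb
    refine ⟨?_, ?_, by linarith, by linarith, by linarith, by linarith⟩ <;>
      simp [Even3, lo, up, env, sum_six, wt,
        q1_val, q2_val, q3_val, q4_val, q5_val, q6_val] <;> linarith
  · refine Or.inr ?_
    refine Or.inr ?_
    refine Or.inr ?_
    refine Or.inr ?_
    refine Or.inl ?_
    rw [show q5.symm 0 = 1 by decide] at ha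
    rw [show q5.symm 1 = 0 by decide] at hb
    simp [Fin.forall_fin_succ, Fin.sum_univ_three, q5_val] at ha hb
    refine ⟨?_, ?_, by linarith, by linarith, by linarith, by linarith⟩ <;>
      simp [Even3, lo, up, env, sum_six, wt,
        q1_val, q2_val, q3_val, q4_val, q5_val, q6_val] <;> linarith
  · refine Or.inr ?_
    refine Or.inr ?_
    refine Or.inr ?_
    refine Or.inr ?_
    refine Or.inr ?_
    rw [show q6.symm 0 = 2 by decide] at ha
    rw [show q6.symm 1 = 1 by decide] at hb
    simp [Fin.forall_fin_succ, Fin.sum_univ_three, q6_val] at ha hb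
    refine ⟨?_, ?_, by linarith, by linarith, by linarith, by linarith⟩ <;>
      simp [Even3, lo, up, env, sum_six, wt,
        q1_val, q2_val, q3_val, q4_val, q5_val, q6_val] <;> linarith

set_option maxHeartbeats 2000000 in
/-- The bounds coming from nonnegativity of the weights. -/
theorem single (P : Fin 3 → Fin 3 → ℝ) (hds : DoublyStochastic 3 P) (r : Equiv.Perm (Fin 3))
    (i : Fin 3) (h : SD P r i) :
    (lo P r i ≤ P 0 0 ∧ lo P r i ≤ P 1 1 ∧ lo P r i ≤ P 2 2) ∧
    (0 ≤ up P r i ∧ P 0 0 - P 1 2 ≤ up P r i ∧ P 2 2 - P 1 0 ≤ up P r i) ∧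
    lo P r i ≤ up P r i := by
  obtain ⟨⟨hr0, hr1, hr2⟩, hc0, hc1, hc2⟩ := ds_facts hds
  have hn := hds.1
  have := hn 0 0; have := hn 0 1; have := hn 0 2
  have := hn 1 0; have := hn 1 1; have := hn 1 2
  have := hn 2 0; have := hn 2 1; have := hn 2 2
  obtain rfl | rfl | rfl : i = 0 ∨ i = 1 ∨ i = 2 := by
    clear h
    revert i
    decide
  · rcases agent0 P hds r h with ⟨h1, h2, h3, h4, h5, h6⟩ | ⟨h1, h2, h3, h4, h5, h6⟩ |
      ⟨h1, h2, h3, h4, h5, h6⟩ | ⟨h1, h2, h3, h4, h5, h6⟩ | ⟨h1, h2, h3, h4, h5, h6⟩ |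
      ⟨h1, h2, h3, h4, h5, h6⟩ <;>
    refine ⟨⟨?_, ?_, ?_⟩, ⟨?_, ?_, ?_⟩, ?_⟩ <;> linarith
  · rcases agent1 P hds r h with ⟨h1, h2, h3, h4, h5, h6⟩ | ⟨h1, h2, h3, h4, h5, h6⟩ |
      ⟨h1, h2, h3, h4, h5, h6⟩ | ⟨h1, h2, h3, h4, h5, h6⟩ | ⟨h1, h2, h3, h4, h5, h6⟩ |
      ⟨h1, h2, h3, h4, h5, h6⟩ <;>
    refine ⟨⟨?_, ?_, ?_⟩, ⟨?_, ?_, ?_⟩, ?_⟩ <;> linarith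
  · rcases agent2 P hds r h with ⟨h1, h2, h3, h4, h5, h6⟩ | ⟨h1, h2, h3, h4, h5, h6⟩ |
      ⟨h1, h2, h3, h4, h5, h6⟩ | ⟨h1, h2, h3, h4, h5, h6⟩ | ⟨h1, h2, h3, h4, h5, h6⟩ |
      ⟨h1, h2, h3, h4, h5, h6⟩ <;>
    refine ⟨⟨?_, ?_, ?_⟩, ⟨?_, ?_, ?_⟩, ?_⟩ <;> linarith

set_option maxHeartbeats 2000000 in
theorem pair01 (P : Fin 3 → Fin 3 → ℝ) (hds : DoublyStochastic 3 P) (r s : Equiv.Perm (Fin 3))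
    (h : SD P r 0) (h' : SD P s 1) : lo P r 0 ≤ up P s 1 ∧ lo P s 1 ≤ up P r 0 := by
  obtain ⟨⟨hr0, hr1, hr2⟩, hc0, hc1, hc2⟩ := ds_facts hds
  have a := agent0 P hds r h
  have b := agent1 P hds s h'
  clear h h' hds
  rcases a with ⟨h1, h2, h3, h4, h5, h6⟩ | ⟨h1, h2, h3, h4, h5, h6⟩ |
      ⟨h1, h2, h3, h4, h5, h6⟩ | ⟨h1, h2, h3, h4, h5, h6⟩ | ⟨h1, h2, h3, h4, h5, h6⟩ |
      ⟨h1, h2, h3, h4, h5, h6⟩ <;>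
    rcases b with ⟨k1, k2, k3, k4, k5, k6⟩ | ⟨k1, k2, k3, k4, k5, k6⟩ |
      ⟨k1, k2, k3, k4, k5, k6⟩ | ⟨k1, k2, k3, k4, k5, k6⟩ | ⟨k1, k2, k3, k4, k5, k6⟩ |
      ⟨k1, k2, k3, k4, k5, k6⟩ <;>
    constructor <;> linarith

set_option maxHeartbeats 2000000 in
theorem pair02 (P : Fin 3 → Fin 3 → ℝ) (hds : DoublyStochastic 3 P) (r s : Equiv.Perm (Fin 3))
    (h : SD P r 0) (h' : SD P s 2) : lo P r 0 ≤ up P s 2 ∧ lo P s 2 ≤ up P r 0 := by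
  obtain ⟨⟨hr0, hr1, hr2⟩, hc0, hc1, hc2⟩ := ds_facts hds
  have a := agent0 P hds r h
  have b := agent2 P hds s h'
  clear h h' hds
  rcases a with ⟨h1, h2, h3, h4, h5, h6⟩ | ⟨h1, h2, h3, h4, h5, h6⟩ |
      ⟨h1, h2, h3, h4, h5, h6⟩ | ⟨h1, h2, h3, h4, h5, h6⟩ | ⟨h1, h2, h3, h4, h5, h6⟩ |
      ⟨h1, h2, h3, h4, h5, h6⟩ <;>
    rcases b with ⟨k1, k2, k3, k4, k5, k6⟩ | ⟨k1, k2, k3, k4, k5, k6⟩ |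
      ⟨k1, k2, k3, k4, k5, k6⟩ | ⟨k1, k2, k3, k4, k5, k6⟩ | ⟨k1, k2, k3, k4, k5, k6⟩ |
      ⟨k1, k2, k3, k4, k5, k6⟩ <;>
    constructor <;> linarith

set_option maxHeartbeats 2000000 in
theorem pair12 (P : Fin 3 → Fin 3 → ℝ) (hds : DoublyStochastic 3 P) (r s : Equiv.Perm (Fin 3))
    (h : SD P r 1) (h' : SD P s 2) : lo P r 1 ≤ up P s 2 ∧ lo P s 2 ≤ up P r 1 := by
  obtain ⟨⟨hr0, hr1, hr2⟩, hc0, hc1, hc2⟩ := ds_facts hds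
  have a := agent1 P hds r h
  have b := agent2 P hds s h'
  clear h h' hds
  rcases a with ⟨h1, h2, h3, h4, h5, h6⟩ | ⟨h1, h2, h3, h4, h5, h6⟩ |
      ⟨h1, h2, h3, h4, h5, h6⟩ | ⟨h1, h2, h3, h4, h5, h6⟩ | ⟨h1, h2, h3, h4, h5, h6⟩ |
      ⟨h1, h2, h3, h4, h5, h6⟩ <;>
    rcases b with ⟨k1, k2, k3, k4, k5, k6⟩ | ⟨k1, k2, k3, k4, k5, k6⟩ |
      ⟨k1, k2, k3, k4, k5, k6⟩ | ⟨k1, k2, k3, k4, k5, k6⟩ | ⟨k1, k2, k3, k4, k5, k6⟩ |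
      ⟨k1, k2, k3, k4, k5, k6⟩ <;>
    constructor <;> linarith

theorem pair (P : Fin 3 → Fin 3 → ℝ) (hds : DoublyStochastic 3 P) (rank : Fin 3 → Equiv.Perm (Fin 3))
    (h : ∀ i, SD P (rank i) i) (i j : Fin 3) : lo P (rank i) i ≤ up P (rank j) j := by
  have d := fun i => (single P hds (rank i) i (h i)).2.2
  have h01 := pair01 P hds _ _ (h 0) (h 1)
  have h02 := pair02 P hds _ _ (h 0) (h 2)
  have h12 := pair12 P hds _ _ (h 1) (h 2)
  fin_cases i <;> fin_cases j
  exacts [d 0, h01.1, h02.1, h01.2, d 1, h12.1, h02.2, h12.2, d 2]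

theorem index_cases : ∀ i i' : Fin 3, i ≠ i' → i' = i + 1 ∨ i' = i + 2 := by
  decide

theorem decomp (P : Fin 3 → Fin 3 → ℝ) (hds : DoublyStochastic 3 P) (x : ℝ)
    (h0 : 0 ≤ x) (h1 : P 0 0 - P 1 2 ≤ x) (h2 : P 2 2 - P 1 0 ≤ x)
    (h3 : x ≤ P 0 0) (h4 : x ≤ P 1 1) (h5 : x ≤ P 2 2) : IsDecomposition 3 P (wt P x) := by
  obtain ⟨hn, hr, hc⟩ := hds
  simp only [Fin.forall_fin_succ, Fin.forall_fin_zero, Fin.sum_univ_three, and_true,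
    Fin.succ_zero_eq_one, Fin.succ_one_eq_two] at hn hr hc
  refine ⟨fun σ => ?_, ?_, fun i o => ?_⟩
  · unfold wt
    split_ifs <;> linarith
  · simp [sum_six, wt, q1_val, q2_val, q3_val, q4_val, q5_val, q6_val]
    linarith
  · rw [Finset.sum_filter, sum_six]
    fin_cases i <;> fin_cases o <;>
      simp [wt, q1_val, q2_val, q3_val, q4_val, q5_val, q6_val] <;> linarith

end ThreeAgents

open ThreeAgents in
/-- Theorem 1, n = 3: every 3×3 doubly stochastic SD-EF matrix admits a
Dec-EF decomposition: a convex combination of permutation matrices such that each agent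
envies each other agent with probability at most 1/2. -/
theorem three_agents_ef_decomposable (rank : Fin 3 → Equiv.Perm (Fin 3))
    (P : Fin 3 → Fin 3 → ℝ) (hds : DoublyStochastic 3 P) (hsdef : SDEF 3 rank P) :
    ∃ w : Equiv.Perm (Fin 3) → ℝ, IsDecomposition 3 P w ∧
      ∀ i i' : Fin 3, i ≠ i' → envyProb 3 rank w i i' ≤ 1 / 2 := by
  have hS : ∀ i, SD P (rank i) i := by
    intro i i' o
    have := hsdef i i' o
    rwa [Finset.sum_filter, Finset.sum_filter] at this
  have hLU := pair P hds rank hS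
  have hs := fun i => single P hds (rank i) i (hS i)
  have hn := hds.1
  have hr := hds.2.1
  have hc := hds.2.2
  simp only [Fin.forall_fin_succ, Fin.forall_fin_zero, Fin.sum_univ_three, and_true,
    Fin.succ_zero_eq_one, Fin.succ_one_eq_two] at hn hr hc
  obtain ⟨x, h0, h1, h2, h3, h4, h5, hl, hu⟩ : ∃ x : ℝ, 0 ≤ x ∧ P 0 0 - P 1 2 ≤ x ∧
      P 2 2 - P 1 0 ≤ x ∧ x ≤ P 0 0 ∧ x ≤ P 1 1 ∧ x ≤ P 2 2 ∧
      (∀ i, lo P (rank i) i ≤ x) ∧ (∀ i, x ≤ up P (rank i) i) := by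
    refine ⟨max (max 0 (max (P 0 0 - P 1 2) (P 2 2 - P 1 0)))
      (Finset.univ.sup' Finset.univ_nonempty fun i => lo P (rank i) i),
      by simp, by simp, by simp, ?_, ?_, ?_, ?_, ?_⟩
    · refine max_le (max_le ?_ (max_le ?_ ?_)) (Finset.sup'_le _ _ fun i _ => (hs i).1.1) <;>
        linarith
    · refine max_le (max_le ?_ (max_le ?_ ?_)) (Finset.sup'_le _ _ fun i _ => (hs i).1.2.1) <;>
        linarith
    · refine max_le (max_le ?_ (max_le ?_ ?_)) (Finset.sup'_le _ _ fun i _ => (hs i).1.2.2) <;>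
        linarith
    · intro i
      exact le_max_of_le_right
        (Finset.le_sup' (fun i => lo P (rank i) i) (Finset.mem_univ i))
    · intro j
      exact max_le (max_le (hs j).2.1.1 (max_le (hs j).2.1.2.1 (hs j).2.1.2.2))
        (Finset.sup'_le _ _ fun i _ => hLU i j)
  refine ⟨wt P x, decomp P hds x h0 h1 h2 h3 h4 h5, fun i i' hne => ?_⟩
  have he : envyProb 3 rank (wt P x) i i' = env P x (rank i) i i' := by
    unfold envyProb env
    rw [Finset.sum_filter]
  rw [he]
  clear he
  have hb := env_le P x (rank i) i (hl i) (hu i)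
  have hi : i' = i + 1 ∨ i' = i + 2 := by
    exact index_cases i i' hne
  rcases hi with rfl | rfl
  · exact hb.1
  · exact hb.2
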